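/- For every positive integer n and every U ⊆ [n], the lattice A_U(n) join-fits within the permutohedron P(n); consequently A_U(n) is a lattice-theoretical retract of P(n): the lower projection π_U : P(n) → A_U(n) is a surjective lattice homomorphism restricting to the identity on A_U(n). -/

import Mathlib

/-- `J_n = {(i,j) : 1 ≤ i < j ≤ n}`. -/
def JnS (n : ℕ) : Set (ℕ × ℕ) := {p | 1 ≤ p.1 ∧ p.1 < p.2 ∧ p.2 ≤ n}

/-- Transitivity of a set of pairs, viewed as a binary relation. -/
def TransSet (x : Set (ℕ × ℕ)) : Prop := ∀ i j k : ℕ, (i, j) ∈ x → (j, k) ∈ x → (i, k) ∈ x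

/-- A subset of `J_n` is closed if it is transitive. -/
def ClosedIn (n : ℕ) (x : Set (ℕ × ℕ)) : Prop := x ⊆ JnS n ∧ TransSet x

/-- A subset of `J_n` is clopen if both it and its complement in `J_n` are closed. -/
def ClopenIn (n : ℕ) (x : Set (ℕ × ℕ)) : Prop := ClosedIn n x ∧ ClosedIn n (JnS n \ x)

/-- The transitive closure of a set of pairs. -/
def clS (x : Set (ℕ × ℕ)) : Set (ℕ × ℕ) :=
  {p | Relation.TransGen (fun a b => (a, b) ∈ x) p.1 p.2}

/-- The interior: the largest open subset of `x`. -/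
def intS (n : ℕ) (x : Set (ℕ × ℕ)) : Set (ℕ × ℕ) := JnS n \ clS (JnS n \ x)

/-- `A_U(n)`: transitive subsets `x ⊆ J_n` such that whenever `i < j < k` and
`(i,k) ∈ x`, then `(i,j) ∈ x` if `j ∈ U` and `(j,k) ∈ x` if `j ∉ U`. -/
def AUset (n : ℕ) (U : Set ℕ) (x : Set (ℕ × ℕ)) : Prop :=
  (x ⊆ JnS n ∧ ∀ i j k : ℕ, i < j → j < k → (i, k) ∈ x →
    ((j ∈ U → (i, j) ∈ x) ∧ (j ∉ U → (j, k) ∈ x))) ∧ TransSet x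

/-- Join-irreducible elements of the permutohedron `P(n)`. -/
def JoinIrrP (n : ℕ) (p : Set (ℕ × ℕ)) : Prop :=
  ClopenIn n p ∧ p ≠ ∅ ∧
    ∀ x y, ClopenIn n x → ClopenIn n y → p = clS (x ∪ y) → p = x ∨ p = y

/-- Join-irreducible elements of `A_U(n)` (joins in `A_U(n)` are `cl (x ∪ y)`). -/
def JoinIrrAU (n : ℕ) (U : Set ℕ) (p : Set (ℕ × ℕ)) : Prop :=
  AUset n U p ∧ p ≠ ∅ ∧
    ∀ x y, AUset n U x → AUset n U y → p = clS (x ∪ y) → p = x ∨ p = y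

/-- The join-dependency relation of `P(n)`. -/
def DrelP (n : ℕ) (p q : Set (ℕ × ℕ)) : Prop :=
  JoinIrrP n q ∧ p ≠ q ∧
    ∃ x, ClopenIn n x ∧ p ⊆ clS (q ∪ x) ∧
      ∀ q', ClopenIn n q' → q' ⊂ q → ¬ p ⊆ clS (q' ∪ x)

theorem mem_JnS {n i j : ℕ} : (i, j) ∈ JnS n ↔ 1 ≤ i ∧ i < j ∧ j ≤ n := Iff.rfl

theorem subset_clS (x : Set (ℕ × ℕ)) : x ⊆ clS x :=
  fun _ hp => Relation.TransGen.single hp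

theorem transSet_clS (x : Set (ℕ × ℕ)) : TransSet (clS x) :=
  fun _ _ _ h₁ h₂ => Relation.TransGen.trans h₁ h₂

theorem clS_subset {x z : Set (ℕ × ℕ)} (hz : TransSet z) (h : x ⊆ z) : clS x ⊆ z := by
  rintro ⟨a, b⟩ hab
  change Relation.TransGen _ a b at hab
  induction hab with
  | single h' => exact h h'
  | tail _ h' ih => exact hz _ _ _ ih (h h')

theorem transSet_JnS (n : ℕ) : TransSet (JnS n) := by
  intro i j k h₁ h₂
  rw [mem_JnS] at *
  omega

/-- The complement of a clopen set being transitive, stated positively. -/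
theorem ClopenIn.left_or_right {n : ℕ} {x : Set (ℕ × ℕ)} (hx : ClopenIn n x) {i j k : ℕ}
    (hij : i < j) (hjk : j < k) (h : (i, k) ∈ x) : (i, j) ∈ x ∨ (j, k) ∈ x := by
  by_contra! hc
  have hJ := mem_JnS.1 (hx.1.1 h)
  exact (hx.2.2 i j k ⟨mem_JnS.2 (by omega), hc.1⟩ ⟨mem_JnS.2 (by omega), hc.2⟩).2 h

theorem clopenIn_of_left_or_right {n : ℕ} {x : Set (ℕ × ℕ)} (hx : ClosedIn n x)
    (h : ∀ i j k, i < j → j < k → (i, k) ∈ x → (i, j) ∈ x ∨ (j, k) ∈ x) : ClopenIn n x := by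
  refine ⟨hx, Set.sdiff_subset, fun i j k h₁ h₂ => ⟨transSet_JnS n i j k h₁.1 h₂.1, fun h₃ => ?_⟩⟩
  exact (h i j k (mem_JnS.1 h₁.1).2.1 (mem_JnS.1 h₂.1).2.1 h₃).elim h₁.2 h₂.2

theorem AUset.clopenIn {n : ℕ} {U : Set ℕ} {x : Set (ℕ × ℕ)} (hx : AUset n U x) :
    ClopenIn n x := by
  refine clopenIn_of_left_or_right ⟨hx.1.1, hx.2⟩ fun i j k hij hjk h => ?_
  by_cases hj : j ∈ U
  · exact Or.inl ((hx.1.2 i j k hij hjk h).1 hj)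
  · exact Or.inr ((hx.1.2 i j k hij hjk h).2 hj)

theorem ClopenIn.clS_union {n : ℕ} {x y : Set (ℕ × ℕ)} (hx : ClopenIn n x)
    (hy : ClopenIn n y) : ClopenIn n (clS (x ∪ y)) := by
  have hsub : clS (x ∪ y) ⊆ JnS n :=
    clS_subset (transSet_JnS n) (Set.union_subset hx.1.1 hy.1.1)
  have step : ∀ i j k, i < j → j < k → (i, k) ∈ x ∪ y →
      (i, j) ∈ clS (x ∪ y) ∨ (j, k) ∈ clS (x ∪ y) := by
    rintro i j k hij hjk (h | h)
    · exact (hx.left_or_right hij hjk h).imp (fun h => subset_clS _ (Or.inl h))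
        (fun h => subset_clS _ (Or.inl h))
    · exact (hy.left_or_right hij hjk h).imp (fun h => subset_clS _ (Or.inr h))
        (fun h => subset_clS _ (Or.inr h))
  refine clopenIn_of_left_or_right ⟨hsub, transSet_clS _⟩ fun i j k hij hjk h => ?_
  change Relation.TransGen _ i k at h
  induction h with
  | single h => exact step _ _ _ hij hjk h
  | @tail b c hib hbc ih =>
    have hbc' : (b, c) ∈ clS (x ∪ y) := subset_clS _ hbc
    rcases lt_trichotomy j b with hjb | rfl | hbj
    · exact (ih hjb).imp id fun h => transSet_clS _ _ _ _ h hbc'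
    · exact Or.inl hib
    · exact (step b j c hbj hjk hbc).imp (fun h => transSet_clS _ _ _ _ hib h) id

/-- The least element of `A_U(n)` containing `(a, b)`. -/
def principalAU (U : Set ℕ) (a b : ℕ) : Set (ℕ × ℕ) :=
  {p | a ≤ p.1 ∧ p.1 < p.2 ∧ p.2 ≤ b ∧ (p.1 = a ∨ p.1 ∉ U) ∧ (p.2 = b ∨ p.2 ∈ U)}

theorem mem_principalAU {U : Set ℕ} {a b i j : ℕ} : (i, j) ∈ principalAU U a b ↔
    a ≤ i ∧ i < j ∧ j ≤ b ∧ (i = a ∨ i ∉ U) ∧ (j = b ∨ j ∈ U) := Iff.rfl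

theorem self_mem_principalAU {U : Set ℕ} {a b : ℕ} (h : a < b) : (a, b) ∈ principalAU U a b :=
  mem_principalAU.2 ⟨le_rfl, h, le_rfl, Or.inl rfl, Or.inl rfl⟩

theorem principalAU_subset_left {U : Set ℕ} {a b c : ℕ} (hcb : c ≤ b) (hc : c ∈ U) :
    principalAU U a c ⊆ principalAU U a b := by
  rintro ⟨i, j⟩ h
  rw [mem_principalAU] at *
  obtain ⟨h₁, h₂, h₃, h₄, h₅⟩ := h
  exact ⟨h₁, h₂, h₃.trans hcb, h₄, Or.inr (h₅.elim (fun h => h ▸ hc) id)⟩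

theorem principalAU_subset_right {U : Set ℕ} {a b c : ℕ} (hac : a ≤ c) (hc : c ∉ U) :
    principalAU U c b ⊆ principalAU U a b := by
  rintro ⟨i, j⟩ h
  rw [mem_principalAU] at *
  obtain ⟨h₁, h₂, h₃, h₄, h₅⟩ := h
  exact ⟨hac.trans h₁, h₂, h₃, Or.inr (h₄.elim (fun h => h ▸ hc) id), h₅⟩

theorem AUset.principalAU_subset {n : ℕ} {U : Set ℕ} {x : Set (ℕ × ℕ)} (hx : AUset n U x)
    {a b : ℕ} (h : (a, b) ∈ x) : principalAU U a b ⊆ x := by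
  rintro ⟨i, j⟩ hij
  obtain ⟨h₁, h₂, h₃, h₄, h₅⟩ := mem_principalAU.1 hij
  have haj : (a, j) ∈ x := by
    rcases h₃.eq_or_lt with rfl | hjb
    · exact h
    · exact (hx.1.2 a j b (by omega) hjb h).1 (h₅.resolve_left hjb.ne)
  rcases h₁.eq_or_lt with rfl | hai
  · exact haj
  · exact (hx.1.2 a i j hai h₂ haj).2 (h₄.resolve_left hai.ne')

/-- The lower projection of `P(n)` onto `A_U(n)`. -/
def lowerProj (n : ℕ) (U : Set ℕ) (x : Set (ℕ × ℕ)) : Set (ℕ × ℕ) :=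
  {p | p ∈ JnS n ∧ principalAU U p.1 p.2 ⊆ x}

theorem mem_lowerProj {n : ℕ} {U : Set ℕ} {x : Set (ℕ × ℕ)} {a b : ℕ} :
    (a, b) ∈ lowerProj n U x ↔ (a, b) ∈ JnS n ∧ principalAU U a b ⊆ x := Iff.rfl

theorem lowerProj_subset (n : ℕ) (U : Set ℕ) (x : Set (ℕ × ℕ)) : lowerProj n U x ⊆ x :=
  fun _ h => h.2 (self_mem_principalAU (mem_JnS.1 h.1).2.1)

theorem lowerProj_mono (n : ℕ) (U : Set ℕ) {x y : Set (ℕ × ℕ)} (h : x ⊆ y) :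
    lowerProj n U x ⊆ lowerProj n U y :=
  fun _ hp => ⟨hp.1, hp.2.trans h⟩

theorem AUset.subset_lowerProj {n : ℕ} {U : Set ℕ} {x y : Set (ℕ × ℕ)} (hy : AUset n U y)
    (h : y ⊆ x) : y ⊆ lowerProj n U x :=
  fun _ hp => ⟨hy.1.1 hp, (hy.principalAU_subset hp).trans h⟩

theorem AUset.lowerProj_eq {n : ℕ} {U : Set ℕ} {x : Set (ℕ × ℕ)} (hx : AUset n U x) :
    lowerProj n U x = x :=
  (lowerProj_subset n U x).antisymm (hx.subset_lowerProj subset_rfl)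

theorem auset_lowerProj (n : ℕ) (U : Set ℕ) {x : Set (ℕ × ℕ)} (hx : TransSet x) :
    AUset n U (lowerProj n U x) := by
  refine ⟨⟨fun _ h => h.1, fun i j k hij hjk h => ?_⟩, fun a b c hab hbc => ?_⟩
  · have hJ := mem_JnS.1 h.1
    exact ⟨fun hj => ⟨mem_JnS.2 (by omega), (principalAU_subset_left hjk.le hj).trans h.2⟩,
      fun hj => ⟨mem_JnS.2 (by omega), (principalAU_subset_right hij.le hj).trans h.2⟩⟩
  · rw [mem_lowerProj] at *
    refine ⟨transSet_JnS n _ _ _ hab.1 hbc.1, ?_⟩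
    have hab' := (mem_JnS.1 hab.1).2.1
    have hbc' := (mem_JnS.1 hbc.1).2.1
    rintro ⟨i, j⟩ hij
    obtain ⟨h₁, h₂, h₃, h₄, h₅⟩ := mem_principalAU.1 hij
    have hi : i < b → (i, b) ∈ x := fun hib =>
      hab.2 (mem_principalAU.2 ⟨h₁, hib, le_rfl, h₄, Or.inl rfl⟩)
    have hj : b < j → (b, j) ∈ x := fun hbj =>
      hbc.2 (mem_principalAU.2 ⟨le_rfl, hbj, h₃, Or.inl rfl, h₅⟩)
    rcases le_or_gt j b with hjb | hbj
    · exact hab.2 (mem_principalAU.2 ⟨h₁, h₂, hjb, h₄, Or.inr (h₅.resolve_left (by omega))⟩)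
    rcases lt_or_ge i b with hib | hbi
    · exact hx _ _ _ (hi hib) (hj hbj)
    · exact hbc.2 (mem_principalAU.2 ⟨hbi, h₂, h₃, Or.inr (h₄.resolve_left (by omega)), h₅⟩)

theorem ClopenIn.principalAU_subset {n : ℕ} {U : Set ℕ} {x : Set (ℕ × ℕ)} (hx : ClopenIn n x)
    {a b : ℕ} (hab : (a, b) ∈ x) (hU : ∀ c ∈ U, a < c → c < b → (c, b) ∉ x)
    (hU' : ∀ c ∉ U, a < c → c < b → (a, c) ∉ x) : principalAU U a b ⊆ x := by
  rintro ⟨i, j⟩ hij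
  obtain ⟨h₁, h₂, h₃, h₄, h₅⟩ := mem_principalAU.1 hij
  have haj : (a, j) ∈ x := by
    rcases h₃.eq_or_lt with rfl | hjb
    · exact hab
    · exact (hx.left_or_right (by omega) hjb hab).resolve_right
        (hU j (h₅.resolve_left hjb.ne) (by omega) hjb)
  rcases h₁.eq_or_lt with rfl | hai
  · exact haj
  · exact (hx.left_or_right hai h₂ haj).resolve_left
      (hU' i (h₄.resolve_left hai.ne') hai (by omega))

/-- A principal element of `A_U(n)` below `z` either splits at an interior point into two
principal elements below `z`, or no interior point of `U` (resp. of its complement) is joined in `z`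
to the right (resp. left) end. -/
theorem exists_split_or_of_principalAU_subset {n : ℕ} {U : Set ℕ} {z : Set (ℕ × ℕ)}
    (hz : ClopenIn n z) {a b : ℕ} (ha : 1 ≤ a) (hb : b ≤ n) (h : principalAU U a b ⊆ z) :
    (∃ c, a < c ∧ c < b ∧ principalAU U a c ⊆ z ∧ principalAU U c b ⊆ z) ∨
      (∀ c ∈ U, a < c → c < b → (c, b) ∉ z) ∧ (∀ c ∉ U, a < c → c < b → (a, c) ∉ z) := by
  by_contra! hcon
  obtain ⟨hsplit, hcon⟩ := hcon
  have hz' : ∀ i j k, 1 ≤ i → i < j → j < k → k ≤ n → (i, j) ∉ z → (j, k) ∉ z → (i, k) ∉ z :=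
    fun i j k _ hij hjk _ h₁ h₂ h₃ => (hz.left_or_right hij hjk h₃).elim h₁ h₂
  have right : ∀ m c, b - c ≤ m → c ∈ U → a < c → c < b → (c, b) ∉ z := by
    intro m
    induction m with
    | zero => intro c _ _ _ _; omega
    | succ m ih =>
      intro c hm hc hac hcb
      have := hsplit c hac hcb ((principalAU_subset_left hcb.le hc).trans h)
      obtain ⟨⟨i, j⟩, hij, hijz⟩ := Set.not_subset.1 this
      obtain ⟨h₁, h₂, h₃, h₄, h₅⟩ := mem_principalAU.1 hij
      have hic : i = c := by
        by_contra hne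
        exact hijz (h (mem_principalAU.2
          ⟨by omega, h₂, h₃, Or.inr (h₄.resolve_left hne), h₅⟩))
      subst hic
      rcases h₃.eq_or_lt with rfl | hjb
      · exact hijz
      · exact hz' i j b (by omega) h₂ hjb hb hijz
          (ih j (by omega) (h₅.resolve_left hjb.ne) (by omega) hjb)
  have left : ∀ m c, c - a ≤ m → c ∉ U → a < c → c < b → (a, c) ∉ z := by
    intro m
    induction m with
    | zero => intro c _ _ _ _; omega
    | succ m ih =>
      intro c hm hc hac hcb
      have : ¬ principalAU U a c ⊆ z := fun h' =>
        hsplit c hac hcb h' ((principalAU_subset_right hac.le hc).trans h)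
      obtain ⟨⟨i, j⟩, hij, hijz⟩ := Set.not_subset.1 this
      obtain ⟨h₁, h₂, h₃, h₄, h₅⟩ := mem_principalAU.1 hij
      have hjc : j = c := by
        by_contra hne
        exact hijz (h (mem_principalAU.2
          ⟨h₁, h₂, by omega, h₄, Or.inr (h₅.resolve_left hne)⟩))
      subst hjc
      rcases h₁.eq_or_lt with rfl | hai
      · exact hijz
      · exact hz' a i j ha hai h₂ (by omega)
          (ih i (by omega) (h₄.resolve_left hai.ne') hai (by omega)) hijz
  obtain ⟨c, hc, hac, hcb, hacz⟩ := hcon fun c hc => right _ c le_rfl hc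
  exact left _ c le_rfl hc hac hcb hacz

theorem lowerProj_clS_union {n : ℕ} (U : Set ℕ) {x y : Set (ℕ × ℕ)} (hx : ClopenIn n x)
    (hy : ClopenIn n y) :
    lowerProj n U (clS (x ∪ y)) = clS (lowerProj n U x ∪ lowerProj n U y) := by
  have hz := hx.clS_union hy
  have hxz : x ⊆ clS (x ∪ y) := Set.subset_union_left.trans (subset_clS _)
  have hyz : y ⊆ clS (x ∪ y) := Set.subset_union_right.trans (subset_clS _)
  apply Set.Subset.antisymm
  · suffices ∀ m a b, b - a ≤ m → (a, b) ∈ lowerProj n U (clS (x ∪ y)) →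
        (a, b) ∈ clS (lowerProj n U x ∪ lowerProj n U y) from fun p hp => this _ p.1 p.2 le_rfl hp
    intro m
    induction m with
    | zero =>
      intro a b hm h
      have := mem_JnS.1 h.1
      omega
    | succ m ih =>
      intro a b hm h
      rw [mem_lowerProj] at h
      have hJ := mem_JnS.1 h.1
      rcases exists_split_or_of_principalAU_subset hz hJ.1 hJ.2.2 h.2 with
        ⟨c, hac, hcb, h₁, h₂⟩ | ⟨hU, hU'⟩
      · exact transSet_clS _ a c b
          (ih a c (by omega) (mem_lowerProj.2 ⟨mem_JnS.2 (by omega), h₁⟩))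
          (ih c b (by omega) (mem_lowerProj.2 ⟨mem_JnS.2 (by omega), h₂⟩))
      · have hab : (a, b) ∈ x ∪ y := by
          have h₀ : Relation.TransGen (fun i j => (i, j) ∈ x ∪ y) a b :=
            h.2 (self_mem_principalAU hJ.2.1)
          rcases Relation.TransGen.tail'_iff.1 h₀ with ⟨c, hac, hcb⟩
          rcases Relation.reflTransGen_iff_eq_or_transGen.1 hac with rfl | hac
          · exact hcb
          · have hcz : (c, b) ∈ clS (x ∪ y) := subset_clS _ hcb
            have hacz : (a, c) ∈ clS (x ∪ y) := hac
            have h₁ := (mem_JnS.1 (hz.1.1 hcz)).2.1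
            have h₂ := (mem_JnS.1 (hz.1.1 hacz)).2.1
            by_cases hc : c ∈ U
            · exact absurd hcz (hU c hc h₂ h₁)
            · exact absurd hacz (hU' c hc h₂ h₁)
        apply subset_clS
        refine hab.imp (fun hab => mem_lowerProj.2 ⟨h.1, hx.principalAU_subset hab ?_ ?_⟩)
          (fun hab => mem_lowerProj.2 ⟨h.1, hy.principalAU_subset hab ?_ ?_⟩)
        · exact fun c hc h₁ h₂ h₃ => hU c hc h₁ h₂ (hxz h₃)
        · exact fun c hc h₁ h₂ h₃ => hU' c hc h₁ h₂ (hxz h₃)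
        · exact fun c hc h₁ h₂ h₃ => hU c hc h₁ h₂ (hyz h₃)
        · exact fun c hc h₁ h₂ h₃ => hU' c hc h₁ h₂ (hyz h₃)
  · exact clS_subset (auset_lowerProj n U hz.1.2).2
      (Set.union_subset (lowerProj_mono n U hxz) (lowerProj_mono n U hyz))

theorem intS_subset {n : ℕ} {x : Set (ℕ × ℕ)} : intS n x ⊆ x := by
  intro p hp
  by_contra h
  exact hp.2 (subset_clS _ ⟨hp.1, h⟩)

theorem ClopenIn.subset_intS {n : ℕ} {w x : Set (ℕ × ℕ)} (hw : ClopenIn n w) (h : w ⊆ x) :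
    w ⊆ intS n x := fun _ hp =>
  ⟨hw.1.1 hp, fun hc => (clS_subset hw.2.2 (Set.sdiff_subset_sdiff_right h) hc).2 hp⟩

theorem AUset.inter {n : ℕ} {U : Set ℕ} {x y : Set (ℕ × ℕ)} (hx : AUset n U x)
    (hy : AUset n U y) : AUset n U (x ∩ y) := by
  refine ⟨⟨fun _ h => hx.1.1 h.1, fun i j k hij hjk h => ?_⟩, fun i j k h₁ h₂ =>
    ⟨hx.2 i j k h₁.1 h₂.1, hy.2 i j k h₁.2 h₂.2⟩⟩
  have hx' := hx.1.2 i j k hij hjk h.1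
  have hy' := hy.1.2 i j k hij hjk h.2
  exact ⟨fun hj => ⟨hx'.1 hj, hy'.1 hj⟩, fun hj => ⟨hx'.2 hj, hy'.2 hj⟩⟩

theorem lowerProj_intS_inter {n : ℕ} (U : Set ℕ) {x y : Set (ℕ × ℕ)} (hx : ClopenIn n x)
    (hy : ClopenIn n y) :
    lowerProj n U (intS n (x ∩ y)) = lowerProj n U x ∩ lowerProj n U y := by
  apply Set.Subset.antisymm
  · exact Set.subset_inter
      (lowerProj_mono n U (intS_subset.trans Set.inter_subset_left))
      (lowerProj_mono n U (intS_subset.trans Set.inter_subset_right))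
  · have hw := (auset_lowerProj n U hx.1.2).inter (auset_lowerProj n U hy.1.2)
    exact hw.subset_lowerProj (hw.clopenIn.subset_intS
      (Set.inter_subset_inter (lowerProj_subset n U x) (lowerProj_subset n U y)))

/-- `A_U(n)` join-fits within `P(n)`; consequently `A_U(n)` is a lattice-theoretical
retract of `P(n)`: the lower projection `π_U` is a surjective lattice homomorphism
from `P(n)` onto `A_U(n)` restricting to the identity on `A_U(n)`. -/
theorem stmt14 (n : ℕ) (hn : 0 < n) (U : Set ℕ) :
    (∀ p, JoinIrrAU n U p → ∀ q, JoinIrrP n q → DrelP n p q → AUset n U q) ∧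
    ∃ π : Set (ℕ × ℕ) → Set (ℕ × ℕ),
      (∀ x, ClopenIn n x → IsGreatest {y | AUset n U y ∧ y ⊆ x} (π x)) ∧
      (∀ x, AUset n U x → π x = x) ∧
      (∀ x y, ClopenIn n x → ClopenIn n y →
        π (clS (x ∪ y)) = clS (π x ∪ π y) ∧ π (intS n (x ∩ y)) = π x ∩ π y) := by
  refine ⟨fun p hp q hq hpq => ?_, lowerProj n U, fun x hx => ?_, fun x hx => hx.lowerProj_eq,
    fun x y hx hy => ⟨lowerProj_clS_union U hx hy, lowerProj_intS_inter U hx hy⟩⟩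
  · obtain ⟨-, -, x, hx, hle, hmin⟩ := hpq
    have hproj := auset_lowerProj n U hq.1.1.2
    have hp' : p ⊆ clS (lowerProj n U q ∪ x) := by
      have h := hp.1.subset_lowerProj hle
      rw [lowerProj_clS_union U hq.1 hx] at h
      exact h.trans (clS_subset (transSet_clS _)
        ((Set.union_subset_union_right _ (lowerProj_subset n U x)).trans (subset_clS _)))
    by_contra hnot
    refine hmin _ hproj.clopenIn ((lowerProj_subset n U q).ssubset_of_ne fun h => ?_) hp'
    exact hnot (h ▸ hproj)
  · exact ⟨⟨auset_lowerProj n U hx.1.2, lowerProj_subset n U x⟩,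
      fun y hy => hy.1.subset_lowerProj hy.2⟩
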